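/- arXiv:1112.4726 — 3 statements merged into one kernel-verified Lean document; each statement's English description precedes it below -/
import Mathlib

section
/- For every nonnegative integer k, ∫_ℝ x^k/cosh(πx)² dx = (2/π)·i^{−k}·B_k(1/2), where B_k denotes the k-th Bernoulli polynomial. -/
open Real MeasureTheory

lemma aux_gamma (k : ℕ) {r : ℝ} (hr : 0 < r) :
    ∫ t in Set.Ioi (0:ℝ), t ^ k * rexp (-(r * t)) = k.factorial / r ^ (k + 1) := by
  have h := Real.integral_rpow_mul_exp_neg_mul_Ioi (a := (k : ℝ) + 1) (r := r) (by positivity) hr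
  rw [Real.Gamma_nat_eq_factorial, add_sub_cancel_right] at h
  simp only [Real.rpow_natCast] at h
  rw [h]
  have : (1 / r) ^ ((k:ℝ) + 1) = (1 / r) ^ (k + 1) := by
    rw [← Real.rpow_natCast]; push_cast; rfl
  rw [this, one_div, inv_pow]
  field_simp

lemma aux_int (k : ℕ) {r : ℝ} (hr : 0 < r) :
    Integrable (fun t : ℝ => t ^ k * rexp (-(r * t))) (volume.restrict (Set.Ioi 0)) := by
  apply Integrable.of_integral_ne_zero
  rw [aux_gamma k hr]
  positivity

lemma aux_cosh (x : ℝ) :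
    1 / Real.cosh (π * x) ^ 2 = 4 * rexp (-(2 * π * x)) / (1 + rexp (-(2 * π * x))) ^ 2 := by
  have h : rexp (-(2 * π * x)) = rexp (-(π * x)) ^ 2 := by
    rw [← Real.exp_nat_mul]; congr 1; push_cast; ring
  have h2 : rexp (π * x) = 1 / rexp (-(π * x)) := by
    rw [Real.exp_neg]; simp
  rw [h, Real.cosh_eq, h2]
  have := Real.exp_pos (-(π * x))
  field_simp
  ring

lemma aux_term (k n : ℕ) (x : ℝ) :
    x ^ k * (n * (-rexp (-(2 * π * x))) ^ n)
      = n * (-1) ^ n * (x ^ k * rexp (-((2 * π * n) * x))) := by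
  rw [neg_pow, ← Real.exp_nat_mul]
  have : (n : ℝ) * -(2 * π * x) = -((2 * π * n) * x) := by ring
  rw [this]; ring

lemma aux_term_int (k n : ℕ) (hk : k ≠ 0) (c : ℝ) :
    ∫ x in Set.Ioi (0:ℝ), n * c * (x ^ k * rexp (-((2 * π * n) * x)))
      = (k.factorial / (2 * π) ^ (k + 1)) * (1 / n ^ k * c) := by
  rw [integral_const_mul]
  rcases Nat.eq_zero_or_pos n with rfl | hn
  · simp [hk]
  · have hn' : (0:ℝ) < n := by exact_mod_cast hn
    rw [aux_gamma k (by positivity)]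
    have := Real.pi_pos
    rw [mul_pow (2 * π) (n : ℝ), pow_succ (n : ℝ)]
    field_simp

lemma aux_main (m : ℕ) (hm : m ≠ 0) :
    ∫ x in Set.Ioi (0:ℝ), x ^ (2 * m) / Real.cosh (π * x) ^ 2
      = (1 / π) * (-1) ^ m * (((Polynomial.bernoulli (2 * m)).eval (1 / 2 : ℚ) : ℚ) : ℝ) := by
  have hk : 2 * m ≠ 0 := by omega
  have h1 : ∀ n : ℕ, Integrable (fun x : ℝ => x ^ (2 * m) * (n * (-rexp (-(2 * π * x))) ^ n))
      (volume.restrict (Set.Ioi 0)) := by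
    intro n
    simp only [aux_term]
    rcases Nat.eq_zero_or_pos n with rfl | hn
    · simp
    · have hn' : (0:ℝ) < n := by exact_mod_cast hn
      exact (aux_int _ (by positivity)).const_mul _
  have h2 : Summable fun n : ℕ => ∫ x in Set.Ioi (0:ℝ),
      ‖x ^ (2 * m) * (n * (-rexp (-(2 * π * x))) ^ n)‖ := by
    have : ∀ n : ℕ, ∫ x in Set.Ioi (0:ℝ),
      ‖x ^ (2 * m) * (n * (-rexp (-(2 * π * x))) ^ n)‖ =
        ((2 * m).factorial / (2 * π) ^ (2 * m + 1)) * (1 / n ^ (2 * m) * 1) := by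
      intro n
      rw [← aux_term_int _ _ hk]
      apply setIntegral_congr_fun measurableSet_Ioi
      intro x hx
      have hx' : (0:ℝ) < x := hx
      simp only [aux_term]
      simp [abs_of_pos hx']
    simp only [this, mul_one]
    apply Summable.mul_left
    exact Real.summable_one_div_nat_pow.2 (by omega)
  have h3 := hasSum_integral_of_summable_integral_norm h1 h2
  have h4 := (hasSum_one_div_nat_pow_mul_cos hm (x := 1 / 2) (by norm_num)).mul_left
    ((2 * m).factorial / (2 * π) ^ (2 * m + 1))
  have h5 : ∀ n : ℕ, ∫ x in Set.Ioi (0:ℝ), x ^ (2 * m) * (n * (-rexp (-(2 * π * x))) ^ n)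
      = ((2 * m).factorial / (2 * π) ^ (2 * m + 1)) *
        (1 / n ^ (2 * m) * cos (2 * π * n * (1 / 2))) := by
    intro n
    have : cos (2 * π * n * (1 / 2)) = (-1) ^ n := by
      rw [← Real.cos_nat_mul_pi]; congr 1; ring
    rw [this, ← aux_term_int _ _ hk]
    simp only [aux_term]
  simp only [h5] at h3
  have h6 := h3.unique h4
  have h7 : ∫ x in Set.Ioi (0:ℝ), x ^ (2 * m) / Real.cosh (π * x) ^ 2
      = ∫ x in Set.Ioi (0:ℝ), (-4) * ∑' n : ℕ, x ^ (2 * m) * (n * (-rexp (-(2 * π * x))) ^ n) := by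
    apply setIntegral_congr_fun measurableSet_Ioi
    intro x hx
    have hx' : (0:ℝ) < x := hx
    have hr : ‖-rexp (-(2 * π * x))‖ < 1 := by
      rw [norm_neg, Real.norm_eq_abs, abs_of_pos (Real.exp_pos _), Real.exp_lt_one_iff]
      have : 0 < 2 * π * x := by positivity
      linarith
    have hs := (hasSum_coe_mul_geometric_of_norm_lt_one hr).mul_left (x ^ (2 * m))
    simp only
    rw [hs.tsum_eq, div_eq_mul_one_div, aux_cosh, sub_neg_eq_add]
    ring
  have h8 : Polynomial.eval (1 / 2 : ℝ)
      (Polynomial.map (algebraMap ℚ ℝ) (Polynomial.bernoulli (2 * m)))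
      = (((Polynomial.bernoulli (2 * m)).eval (1 / 2 : ℚ) : ℚ) : ℝ) := by
    have : (1 / 2 : ℝ) = algebraMap ℚ ℝ (1 / 2) := by simp
    rw [this, Polynomial.eval_map, Polynomial.eval₂_at_apply]; rfl
  rw [h7, integral_const_mul, h6, h8]
  have := Real.pi_pos
  have hf : ((2 * m).factorial : ℝ) ≠ 0 := by positivity
  rw [pow_succ (2 * π), pow_succ (-1 : ℝ)]
  field_simp
  ring

lemma aux_zero :
    ∫ x in Set.Ioi (0:ℝ), 1 / Real.cosh (π * x) ^ 2 = 1 / π := by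
  have hp := Real.pi_pos
  have h := integral_Ioi_of_hasDerivAt_of_nonneg' (a := 0) (l := 1 / π)
    (g := fun x => 1 / π * (2 / (1 + rexp (-(2 * π * x))) - 1))
    (g' := fun x => 1 / Real.cosh (π * x) ^ 2) ?_ ?_ ?_
  · rw [h]; norm_num
  · intro x _
    have hpos := Real.exp_pos (-(2 * π * x))
    have h1 : HasDerivAt (fun x : ℝ => -(2 * π * x)) (-(2 * π)) x := by
      have h := ((hasDerivAt_id x).const_mul (2 * π)).neg
      rw [mul_one] at h
      exact h
    have h2 := ((((h1.exp.const_add 1).inv (by positivity)).const_mul 2).sub_const 1).const_mul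
      (1 / π)
    simp only [aux_cosh]
    refine HasDerivAt.congr_deriv (f' := _) h2 ?_
    field_simp
    ring
  · intro x _; positivity
  · have h1 : Filter.Tendsto (fun x : ℝ => rexp (-(2 * π * x))) Filter.atTop (nhds 0) :=
      Real.tendsto_exp_neg_atTop_nhds_zero.comp
        (Filter.tendsto_id.const_mul_atTop (by positivity))
    have h2 := (((h1.const_add 1).inv₀ (by norm_num)).const_mul 2).sub_const 1 |>.const_mul (1 / π)
    simp only [div_eq_mul_inv] at h2 ⊢
    convert h2 using 2
    norm_num

lemma aux_even (m : ℕ) :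
    ∫ x : ℝ, x ^ (2 * m) / Real.cosh (π * x) ^ 2
      = (2 / π) * (-1) ^ m * (((Polynomial.bernoulli (2 * m)).eval (1 / 2 : ℚ) : ℚ) : ℝ) := by
  have h := integral_comp_abs (f := fun x => x ^ (2 * m) / Real.cosh (π * x) ^ 2)
  have h2 : ∀ x : ℝ, |x| ^ (2 * m) / Real.cosh (π * |x|) ^ 2
      = x ^ (2 * m) / Real.cosh (π * x) ^ 2 := by
    intro x
    rcases abs_choice x with hx | hx <;> rw [hx]
    rw [mul_neg, Real.cosh_neg, (even_two_mul m).neg_pow]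
  simp only [h2] at h
  rw [h]
  rcases eq_or_ne m 0 with rfl | hm
  · have := aux_zero
    simp only [mul_zero, pow_zero]
    rw [this]
    simp
    ring
  · rw [aux_main m hm]; ring

/-- For every nonnegative integer `k`,
`∫_ℝ x^k/cosh(πx)² dx = (2/π)·i^{−k}·B_k(1/2)`,
where `B_k` denotes the `k`-th Bernoulli polynomial. -/
theorem stmt_1 (k : ℕ) :
    ∫ x : ℝ, (x : ℂ) ^ k / (Real.cosh (π * x) : ℂ) ^ 2
      = (2 / π) * Complex.I ^ (-(k : ℤ)) *
          (((Polynomial.bernoulli k).eval (1 / 2 : ℚ) : ℚ) : ℂ) := by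
  have h0 : ∫ x : ℝ, (x : ℂ) ^ k / (Real.cosh (π * x) : ℂ) ^ 2
      = ((∫ x : ℝ, x ^ k / Real.cosh (π * x) ^ 2 : ℝ) : ℂ) := by
    rw [← integral_complex_ofReal]
    congr 1
    ext x
    push_cast
    rfl
  rw [h0]
  rcases Nat.even_or_odd' k with ⟨m, rfl | rfl⟩
  · rw [aux_even]
    have : Complex.I ^ (-((2 * m : ℕ) : ℤ)) = (-1) ^ m := by
      rw [zpow_neg, zpow_natCast, pow_mul, Complex.I_sq, ← inv_pow]
      norm_num
    rw [this]
    push_cast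
    rfl
  · have h1 : ∫ x : ℝ, x ^ (2 * m + 1) / Real.cosh (π * x) ^ 2 = 0 := by
      have h := integral_neg_eq_self (fun x : ℝ => x ^ (2 * m + 1) / Real.cosh (π * x) ^ 2) volume
      simp only [mul_neg, Real.cosh_neg, (odd_two_mul_add_one m).neg_pow, neg_div,
        integral_neg] at h
      linarith
    have h2 : (Polynomial.bernoulli (2 * m + 1)).eval (1 / 2 : ℚ) = 0 := by
      have h := Polynomial.bernoulli_eval_one_sub (2 * m + 1) (1 / 2)
      rw [(odd_two_mul_add_one m).neg_one_pow] at h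
      norm_num at h ⊢
      linarith
    rw [h1, h2]
    simp
end

section
/- For every nonnegative integer k, ∫_ℝ x^k/cosh(πx) dx = (−2i)^{−k}·E_k, where E_k denotes the k-th Euler number. -/
open Real MeasureTheory

lemma aux_sig (x : ℝ) : Real.sigmoid (2 * π * x) = rexp (π * x) / (2 * Real.cosh (π * x)) := by
  have h := Real.cosh_pos (π * x)
  rw [Real.sigmoid_def, inv_eq_one_div, div_eq_div_iff (by positivity) (by positivity), Real.cosh_eq]
  have e : rexp (π * x) * rexp (-(2 * π * x)) = rexp (-(π * x)) := by
    rw [← Real.exp_add]; congr 1; ring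
  rw [mul_add, e]; ring

lemma aux_sig' (x : ℝ) : 1 - Real.sigmoid (2 * π * x) = rexp (-(π * x)) / (2 * Real.cosh (π * x)) := by
  rw [← Real.sigmoid_neg, show -(2 * π * x) = 2 * π * (-x) by ring, aux_sig]
  simp

lemma aux_cpow (x : ℝ) (y : ℝ) (w : ℂ) :
    (((rexp y / (2 * Real.cosh x) : ℝ)) : ℂ) ^ w
      = Complex.exp (((y - Real.log (2 * Real.cosh x) : ℝ) : ℂ) * w) := by
  have h := Real.cosh_pos x
  have hp : 0 < rexp y / (2 * Real.cosh x) := by positivity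
  rw [Complex.cpow_def_of_ne_zero (by exact_mod_cast hp.ne'), ← Complex.ofReal_log hp.le,
    Real.log_div (by positivity) (by positivity), Real.log_exp]

lemma aux_point (z : ℂ) (x : ℝ) :
    |Real.sigmoid (2 * π * x) * (1 - Real.sigmoid (2 * π * x)) * (2 * π)| •
      (((Real.sigmoid (2 * π * x) : ℝ) : ℂ) ^ ((1 / 2 + z / (2 * π)) - 1 : ℂ)
        * (1 - ((Real.sigmoid (2 * π * x) : ℝ) : ℂ)) ^ ((1 / 2 - z / (2 * π)) - 1 : ℂ))
      = π * (Complex.exp (z * x) / (Real.cosh (π * x) : ℂ)) := by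
  have hc := Real.cosh_pos (π * x)
  have h1 : (1 - ((Real.sigmoid (2 * π * x) : ℝ) : ℂ))
      = ((rexp (-(π * x)) / (2 * Real.cosh (π * x)) : ℝ) : ℂ) := by
    rw [← aux_sig']; push_cast; rfl
  rw [h1, aux_sig', aux_sig, aux_cpow, aux_cpow, ← Complex.exp_add]
  have e : rexp (π * x) / (2 * Real.cosh (π * x)) * (rexp (-(π * x)) / (2 * Real.cosh (π * x))) * (2 * π)
      = π / (2 * Real.cosh (π * x) ^ 2) := by
    rw [div_mul_div_comm, ← Real.exp_add]; simp; field_simp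
  rw [e, abs_of_pos (by positivity)]
  have hπ : (π : ℂ) ≠ 0 := by exact_mod_cast pi_ne_zero
  have e2 : ((π * x - Real.log (2 * Real.cosh (π * x)) : ℝ) : ℂ) * ((1 / 2 + z / (2 * π)) - 1 : ℂ)
      + ((-(π * x) - Real.log (2 * Real.cosh (π * x)) : ℝ) : ℂ) * ((1 / 2 - z / (2 * π)) - 1 : ℂ)
      = z * x + (Real.log (2 * Real.cosh (π * x)) : ℝ) := by
    push_cast; field_simp; ring
  rw [e2, Complex.exp_add, ← Complex.ofReal_exp, Real.exp_log (by positivity)]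
  have hcc : (Real.cosh (π * x) : ℂ) ≠ 0 := by exact_mod_cast hc.ne'
  rw [Complex.real_smul]
  push_cast at hcc ⊢
  field_simp

lemma aux_image : (fun x : ℝ => Real.sigmoid (2 * π * x)) '' Set.univ = Set.Ioo 0 1 := by
  rw [Set.image_univ, ← Real.range_sigmoid]
  have : (fun x : ℝ => Real.sigmoid (2 * π * x)) = Real.sigmoid ∘ (fun x => 2 * π * x) := rfl
  rw [this, Function.Surjective.range_comp]
  intro y
  exact ⟨y / (2 * π), by field_simp⟩

lemma aux_deriv (x : ℝ) (_ : x ∈ Set.univ) :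
    HasDerivWithinAt (fun x : ℝ => Real.sigmoid (2 * π * x))
      (Real.sigmoid (2 * π * x) * (1 - Real.sigmoid (2 * π * x)) * (2 * π)) Set.univ x := by
  have := (Real.hasDerivAt_sigmoid (2 * π * x)).comp x ((hasDerivAt_id x).const_mul (2 * π))
  simpa [Function.comp_def] using this.hasDerivWithinAt (s := Set.univ)

lemma aux_inj : Set.InjOn (fun x : ℝ => Real.sigmoid (2 * π * x)) Set.univ := by
  intro a _ b _ h
  have := Real.sigmoid_injective h
  have hp := pi_pos
  exact mul_left_cancel₀ (by positivity) this

lemma aux_re (z : ℂ) : (z / (2 * π)).re = z.re / (2 * π) := by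
  rw [show (2 * π : ℂ) = ((2 * π : ℝ) : ℂ) by push_cast; rfl, Complex.div_ofReal_re]

lemma aux_bd {z : ℂ} (hz : |z.re| < π) :
    0 < (1 / 2 + z / (2 * π) : ℂ).re ∧ 0 < (1 / 2 - z / (2 * π) : ℂ).re := by
  have hp := pi_pos
  obtain ⟨h1, h2⟩ := abs_lt.1 hz
  have : z.re / (2 * π) < 1 / 2 := by rw [div_lt_div_iff₀ (by positivity) (by positivity)]; linarith
  have : -(1 / 2) < z.re / (2 * π) := by rw [lt_div_iff₀ (by positivity)]; linarith
  rw [Complex.add_re, Complex.sub_re, aux_re]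
  norm_num
  constructor <;> linarith

lemma aux_integrable {z : ℂ} (hz : |z.re| < π) :
    Integrable (fun x : ℝ => Complex.exp (z * x) / (Real.cosh (π * x) : ℂ)) := by
  obtain ⟨h1, h2⟩ := aux_bd hz
  have h := Complex.betaIntegral_convergent h1 h2
  rw [intervalIntegrable_iff_integrableOn_Ioo_of_le zero_le_one, ← aux_image,
    integrableOn_image_iff_integrableOn_abs_deriv_smul MeasurableSet.univ aux_deriv aux_inj] at h
  simp only [aux_point, integrableOn_univ] at h
  have hπ : (π : ℂ) ≠ 0 := by exact_mod_cast pi_ne_zero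
  convert h.const_mul (π : ℂ)⁻¹ using 2
  field_simp

lemma aux_integral {z : ℂ} (hz : |z.re| < π) :
    ∫ x : ℝ, Complex.exp (z * x) / (Real.cosh (π * x) : ℂ) = 1 / Complex.cos (z / 2) := by
  obtain ⟨h1, h2⟩ := aux_bd hz
  have h := Complex.betaIntegral_eq_Gamma_mul_div _ _ h1 h2
  have hπ : (π : ℂ) ≠ 0 := by exact_mod_cast pi_ne_zero
  have e1 : (1 / 2 + z / (2 * π) : ℂ) + (1 / 2 - z / (2 * π)) = 1 := by ring
  have e2 : (1 / 2 - z / (2 * π) : ℂ) = 1 - (1 / 2 + z / (2 * π)) := by ring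
  rw [e1, Complex.Gamma_one, div_one] at h
  have h3 : Complex.Gamma (1 / 2 + z / (2 * π)) * Complex.Gamma (1 / 2 - z / (2 * π))
      = π / Complex.cos (z / 2) := by
    rw [e2, Complex.Gamma_mul_Gamma_one_sub, ← Complex.sin_add_pi_div_two]
    congr 2
    field_simp
    ring
  rw [h3, Complex.betaIntegral, intervalIntegral.integral_of_le zero_le_one,
    integral_Ioc_eq_integral_Ioo, ← aux_image,
    integral_image_eq_integral_abs_deriv_smul MeasurableSet.univ aux_deriv aux_inj] at h
  simp only [aux_point, Measure.restrict_univ] at h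
  rw [integral_const_mul] at h
  apply mul_left_cancel₀ hπ
  rw [h]; ring

lemma aux_hasSum {s : ℝ} (hs : |s| < π) :
    HasSum (fun k : ℕ => ∫ x : ℝ, ((Complex.I * s) ^ k / k.factorial) *
      ((x : ℂ) ^ k / (Real.cosh (π * x) : ℂ))) (1 / (Real.cosh (s / 2) : ℂ)) := by
  have h0 : ∫ x : ℝ, Complex.exp (Complex.I * s * x) / (Real.cosh (π * x) : ℂ)
      = 1 / (Real.cosh (s / 2) : ℂ) := by
    rw [aux_integral (by simp [pi_pos])]
    push_cast
    rw [← Complex.cos_mul_I]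
    congr 2; ring
  rw [← h0]
  have hex (y : ℝ) : HasSum (fun n : ℕ => y ^ n / n.factorial) (rexp y) := by
    rw [Real.exp_eq_exp_ℝ]; exact NormedSpace.expSeries_div_hasSum_exp y
  have hexc (y : ℂ) : HasSum (fun n : ℕ => y ^ n / n.factorial) (Complex.exp y) := by
    rw [Complex.exp_eq_exp_ℂ]; exact NormedSpace.expSeries_div_hasSum_exp y
  have hb (x : ℝ) : HasSum (fun n : ℕ => |s * x| ^ n / n.factorial / Real.cosh (π * x))
      (rexp |s * x| / Real.cosh (π * x)) := (hex _).div_const _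
  have hcont : Continuous fun x : ℝ => (Real.cosh (π * x)) := by fun_prop
  have hne (x : ℝ) : Real.cosh (π * x) ≠ 0 := (Real.cosh_pos _).ne'
  have hneC (x : ℝ) : (Real.cosh (π * x) : ℂ) ≠ 0 := by exact_mod_cast hne x
  refine hasSum_integral_of_dominated_convergence
    (fun n x => |s * x| ^ n / n.factorial / Real.cosh (π * x)) ?_ ?_ ?_ ?_ ?_
  · intro n
    apply Continuous.aestronglyMeasurable
    refine continuous_const.mul (Continuous.div (by fun_prop) (by fun_prop) hneC)
  · intro n
    refine Filter.Eventually.of_forall fun x => le_of_eq ?_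
    rw [norm_mul, norm_div, norm_div, norm_pow, norm_pow, norm_mul, Complex.norm_I,
      Complex.norm_real, Complex.norm_real, Complex.norm_real, Complex.norm_natCast,
      Real.norm_eq_abs, Real.norm_eq_abs, Real.norm_eq_abs, abs_of_pos (Real.cosh_pos _), abs_mul]
    ring
  · exact Filter.Eventually.of_forall fun x => (hb x).summable
  · simp only [fun x => (hb x).tsum_eq]
    have i1 := (aux_integrable (z := (s : ℂ)) (by simpa using hs)).norm
    have i2 := (aux_integrable (z := ((-s : ℝ) : ℂ)) (by simpa using hs)).norm
    refine (i1.add i2).mono' ?_ ?_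
    · apply Continuous.aestronglyMeasurable
      exact Continuous.div (by fun_prop) (by fun_prop) hne
    · refine Filter.Eventually.of_forall fun x => ?_
      have hc := Real.cosh_pos (π * x)
      simp only [Pi.add_apply, norm_div, ← Complex.ofReal_mul, ← Complex.ofReal_exp,
        Complex.norm_real, Real.norm_eq_abs, Real.abs_exp, abs_of_pos hc]
      rw [← add_div]
      gcongr
      rcases abs_cases (s * x) with ⟨h, _⟩ | ⟨h, _⟩ <;> rw [h]
      · have := Real.exp_pos (-s * x); linarith
      · have := Real.exp_pos (s * x); rw [← neg_mul]; linarith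
  · refine Filter.Eventually.of_forall fun x => ?_
    have := (hexc (Complex.I * s * x)).div_const (Real.cosh (π * x) : ℂ)
    have e : (fun i : ℕ => (Complex.I * s * x) ^ i / i.factorial / (Real.cosh (π * x) : ℂ))
        = fun k : ℕ => ((Complex.I * s) ^ k / k.factorial) * ((x : ℂ) ^ k / (Real.cosh (π * x) : ℂ)) := by
      funext k
      rw [mul_pow (Complex.I * s)]; ring
    rw [e] at this
    exact this

noncomputable def auxP (c : ℕ → ℂ) : FormalMultilinearSeries ℝ ℝ ℂ :=
  fun n => ContinuousMultilinearMap.mkPiRing ℝ (Fin n) (c n)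

lemma auxP_coeff (c : ℕ → ℂ) (n : ℕ) : (auxP c).coeff n = c n := by
  simp [auxP, FormalMultilinearSeries.coeff]

lemma aux_unique (c d : ℕ → ℂ) (f : ℝ → ℂ)
    (hc : ∀ s : ℝ, |s| < π → HasSum (fun k : ℕ => (s ^ k) • c k) (f s))
    (hd : ∀ s : ℝ, |s| < π → HasSum (fun k : ℕ => (s ^ k) • d k) (f s)) : c = d := by
  have key : ∀ c : ℕ → ℂ, (∀ s : ℝ, |s| < π → HasSum (fun k : ℕ => (s ^ k) • c k) (f s)) →
      HasFPowerSeriesAt f (auxP c) 0 := by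
    intro c hc
    refine hasFPowerSeriesAt_iff.2 ?_
    filter_upwards [Metric.ball_mem_nhds (0 : ℝ) pi_pos] with s hs
    have := hc s (by simpa using hs)
    simpa only [auxP_coeff, zero_add] using this
  have h := (key c hc).eq_formalMultilinearSeries (key d hd)
  funext n
  rw [← auxP_coeff c, h, auxP_coeff]

/-- For every nonnegative integer `k`, `∫_ℝ x^k/cosh(πx) dx = (−2i)^{−k}·E_k`, where the
Euler numbers `E_k` are characterized by the generating function
`∑_{k≥0} E_k x^k/k! = 1/cosh(x)`, valid for `|x| < π/2`. -/
theorem stmt_2 (E : ℕ → ℝ)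
    (hE : ∀ x : ℝ, |x| < π / 2 →
      HasSum (fun k : ℕ => E k * x ^ k / k.factorial) (1 / Real.cosh x))
    (k : ℕ) :
    ∫ x : ℝ, (x : ℂ) ^ k / (Real.cosh (π * x) : ℂ)
      = (-2 * Complex.I) ^ (-(k : ℤ)) * (E k : ℂ) := by
  have hu := aux_unique
    (fun k => (Complex.I ^ k / k.factorial) * ∫ x : ℝ, (x : ℂ) ^ k / (Real.cosh (π * x) : ℂ))
    (fun k => (-1 / 2) ^ k * (E k : ℂ) / k.factorial)
    (fun s => 1 / (Real.cosh (s / 2) : ℂ)) ?_ ?_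
  · have h := congrFun hu k
    have hf : (k.factorial : ℂ) ≠ 0 := by exact_mod_cast k.factorial_ne_zero
    have h1 : Complex.I ^ k * ∫ x : ℝ, (x : ℂ) ^ k / (Real.cosh (π * x) : ℂ)
        = (-1 / 2) ^ k * (E k : ℂ) := by
      field_simp at h
      rw [h, neg_div]
    have hI : Complex.I ^ k ≠ 0 := pow_ne_zero _ Complex.I_ne_zero
    apply mul_left_cancel₀ hI
    rw [h1, zpow_neg, zpow_natCast, ← inv_pow, ← mul_assoc, ← mul_pow]
    congr 2
    rw [mul_inv, Complex.inv_I]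
    linear_combination (-1 / 2 : ℂ) * Complex.I_mul_I
  · intro s hs
    have := aux_hasSum hs
    have e : (fun k : ℕ => ∫ x : ℝ, ((Complex.I * s) ^ k / k.factorial) *
        ((x : ℂ) ^ k / (Real.cosh (π * x) : ℂ))) = fun k : ℕ => (s ^ k) •
        ((Complex.I ^ k / k.factorial) * ∫ x : ℝ, (x : ℂ) ^ k / (Real.cosh (π * x) : ℂ)) := by
      funext k
      rw [integral_const_mul, Complex.real_smul, mul_pow, Complex.ofReal_pow]; ring
    rw [e] at this
    exact this
  · intro s hs
    have := hE (-(s / 2)) (by rw [abs_neg, abs_div, abs_two]; linarith)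
    rw [Real.cosh_neg] at this
    have h2 := Complex.hasSum_ofReal.2 this
    push_cast at h2 ⊢
    convert h2 using 2 with n
    rw [Complex.real_smul, show (-((s : ℂ) / 2)) = s * (-1 / 2) by ring, mul_pow]; push_cast; ring
end

section
/- Let m be a positive even integer. For every τ ∈ ℍ, lim_{ε→0} (2πiε)² · ϑ(ε + 1/2; τ)^m / ϑ(ε; τ)² = −2^m · η(2τ)^{2m} / η(τ)^{m+6}. (This is the leading Laurent coefficient D₂(τ) of ϑ(ε+1/2;τ)^m/ϑ(ε;τ)² at ε = 0.) -/
open Real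

/-- The Jacobi theta function
`ϑ(z;τ) := ∑_{ν ∈ 1/2 + ℤ} e^{πiν²τ + 2πiν(z+1/2)}`, parametrized by `ν = n + 1/2, n ∈ ℤ`. -/
noncomputable def jacobiThetaKW (z τ : ℂ) : ℂ :=
  ∑' n : ℤ, Complex.exp (π * Complex.I * ((n : ℂ) + 1 / 2) ^ 2 * τ +
      2 * π * Complex.I * ((n : ℂ) + 1 / 2) * (z + 1 / 2))

/-- The Dedekind eta function `η(τ) := q^{1/24} ∏_{k=1}^∞ (1 − q^k)`, `q = e^{2πiτ}`. -/
noncomputable def dedekindEta (τ : ℂ) : ℂ :=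
  Complex.exp (π * Complex.I * τ / 12) *
    ∏' k : ℕ, (1 - Complex.exp (2 * π * Complex.I * τ * ((k : ℂ) + 1)))

open Filter Topology

namespace KW

noncomputable def PP (q : ℂ) (n : ℕ) : ℂ := ∏ k ∈ Finset.range n, (1 - q ^ (k + 1))

noncomputable def RR (q : ℂ) (k : ℤ) : ℂ := if k < 0 then 0 else (PP q k.toNat)⁻¹

noncomputable def Pinf (q : ℂ) : ℂ := ∏' k : ℕ, (1 - q ^ (k + 1))

lemma one_sub_ne {q : ℂ} (hq : ‖q‖ < 1) (k : ℕ) : 1 - q ^ (k + 1) ≠ 0 := by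
  intro h
  have h1 : q ^ (k + 1) = 1 := (sub_eq_zero.mp h).symm
  have h2 : ‖q‖ ^ (k + 1) = 1 := by rw [← norm_pow, h1, norm_one]
  have h3 : ‖q‖ ^ (k + 1) < 1 := pow_lt_one₀ (norm_nonneg _) hq (by omega)
  linarith

lemma PP_ne {q : ℂ} (hq : ‖q‖ < 1) (n : ℕ) : PP q n ≠ 0 :=
  Finset.prod_ne_zero_iff.mpr fun k _ => one_sub_ne hq k

lemma PP_succ (q : ℂ) (n : ℕ) : PP q (n + 1) = PP q n * (1 - q ^ (n + 1)) :=
  Finset.prod_range_succ _ _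

lemma PP_tendsto {q : ℂ} (hq : ‖q‖ < 1) : Tendsto (PP q) atTop (𝓝 (Pinf q)) :=
  (ModularForm.multipliable_one_sub_pow hq).tendsto_prod_tprod_nat

lemma Pinf_ne {q : ℂ} (hq : ‖q‖ < 1) : Pinf q ≠ 0 := by
  have := tprod_one_add_ne_zero_of_summable (f := fun n : ℕ => -q ^ (n + 1))
    (fun i => by simpa [sub_eq_add_neg] using one_sub_ne hq i)
    (by simpa using (summable_nat_add_iff 1).mpr (summable_geometric_of_lt_one (norm_nonneg _) hq))
  simpa [Pinf, sub_eq_add_neg] using this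

lemma RR_rec {q : ℂ} (hq : ‖q‖ < 1) (k : ℤ) : RR q (k - 1) = (1 - q ^ k) * RR q k := by
  rcases lt_trichotomy k 0 with h | h | h
  · simp [RR, h, show k - 1 < 0 by omega]
  · subst h; simp [RR]
  · obtain ⟨n, rfl⟩ : ∃ n : ℕ, k = n + 1 := ⟨(k - 1).toNat, by omega⟩
    have h1 : ((n : ℤ) + 1).toNat = n + 1 := by omega
    have h2 : ¬ ((n : ℤ) + 1 < 0) := by omega
    have := one_sub_ne hq n
    have := PP_ne hq n
    have h3 : q ^ ((n : ℤ) + 1) = q ^ (n + 1) := by exact_mod_cast zpow_natCast q (n + 1)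
    simp only [RR, add_sub_cancel_right, h1, h2, PP_succ, h3, if_false]
    have h4 : ¬ ((n : ℤ) < 0) := by omega
    simp only [h4, if_false, Int.toNat_natCast]
    field_simp

lemma hs_sub {f : ℤ → ℂ} {a : ℂ} (h : HasSum f a) : HasSum (fun j => f (j - 1)) a :=
  (Equiv.subRight (1 : ℤ)).hasSum_iff.mpr h

lemma hs_add {f : ℤ → ℂ} {a : ℂ} (h : HasSum f a) : HasSum (fun j => f (j + 1)) a :=
  (Equiv.addRight (1 : ℤ)).hasSum_iff.mpr h

noncomputable def aa (q : ℂ) (E : ℤ → ℂ) (n : ℕ) (j : ℤ) : ℂ :=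
  PP q (2 * n) * RR q (n + j) * RR q (n - j) * E j

lemma aa_rec {q s : ℂ} (hq0 : q ≠ 0) (hq : ‖q‖ < 1) (hs : s ^ 2 = 1) (E : ℤ → ℂ)
    (hE : ∀ j, E (j + 1) = s * q ^ (j + 1) * E j) (n : ℕ) (j : ℤ) :
    aa q E (n + 1) j = (1 + q ^ (2 * n + 1)) * aa q E n j + s * q ^ (n + 1) * aa q E n (j - 1)
      + s * q ^ n * aa q E n (j + 1) := by
  have e1 : E j = s * q ^ j * E (j - 1) := by simpa using hE (j - 1)
  have e2 := hE j
  have a1 := RR_rec hq (n + 1 + j)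
  have a2 := RR_rec hq (n + j)
  have b1 := RR_rec hq (n + 1 - j)
  have b2 := RR_rec hq (n - j)
  rw [show (n : ℤ) + 1 + j - 1 = n + j by ring] at a1
  rw [show (n : ℤ) + 1 - j - 1 = n - j by ring] at b1
  rw [a1] at a2
  rw [b1] at b2
  have hPP : PP q (2 * (n + 1)) = PP q (2 * n) * (1 - q ^ (2 * n + 1)) * (1 - q ^ (2 * n + 2)) := by
    rw [show 2 * (n + 1) = 2 * n + 1 + 1 by ring, PP_succ, PP_succ]
  unfold aa
  push_cast
  rw [hPP, show (n : ℤ) + (j - 1) = n + j - 1 by ring, show (n : ℤ) - (j - 1) = n + 1 - j by ring,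
    show (n : ℤ) + (j + 1) = n + 1 + j by ring, show (n : ℤ) - (j + 1) = n - j - 1 by ring,
    a2, b2, a1, b1, e2, e1]
  have hv : q ^ j ≠ 0 := zpow_ne_zero _ hq0
  have hu : q ^ n ≠ 0 := pow_ne_zero _ hq0
  simp only [zpow_add₀ hq0, zpow_sub₀ hq0, zpow_natCast, zpow_one, pow_add, pow_mul', pow_one]
  generalize q ^ j = v at *
  generalize q ^ n = u at *
  generalize RR q _ = A
  generalize RR q _ = B
  generalize E _ = F
  generalize PP q _ = G
  field_simp
  have hs3 : s ^ 3 = s := by linear_combination s * hs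
  ring_nf
  try rw [hs3]
  try rw [hs]
  try ring

lemma PP_bdd {q : ℂ} (hq : ‖q‖ < 1) : ∃ C, ∀ n, ‖PP q n‖ ≤ C := by
  obtain ⟨C, hC⟩ := (PP_tendsto hq).norm.bddAbove_range
  exact ⟨C, fun n => hC ⟨n, rfl⟩⟩

lemma RR_bdd {q : ℂ} (hq : ‖q‖ < 1) : ∃ C, 0 ≤ C ∧ ∀ k, ‖RR q k‖ ≤ C := by
  obtain ⟨C, hC⟩ := ((PP_tendsto hq).inv₀ (Pinf_ne hq)).norm.bddAbove_range
  have h0 : 0 ≤ C := (norm_nonneg _).trans (hC ⟨0, rfl⟩)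
  refine ⟨C, h0, fun k => ?_⟩
  unfold RR
  split_ifs
  · simpa using h0
  · exact hC ⟨k.toNat, rfl⟩

lemma RR_tendsto {q : ℂ} (hq : ‖q‖ < 1) : Tendsto (RR q) atTop (𝓝 (Pinf q)⁻¹) := by
  have h1 : Tendsto Int.toNat atTop atTop := by
    refine tendsto_atTop.mpr fun b => ?_
    filter_upwards [eventually_ge_atTop (b : ℤ)] with a ha
    omega
  refine (((PP_tendsto hq).inv₀ (Pinf_ne hq)).comp h1).congr' ?_
  filter_upwards [eventually_ge_atTop 0] with a ha
  simp [RR, not_lt.mpr ha]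

lemma aa_bdd {q : ℂ} (hq : ‖q‖ < 1) : ∃ C, ∀ (E : ℤ → ℂ) n j, ‖aa q E n j‖ ≤ C * ‖E j‖ := by
  obtain ⟨A, hA⟩ := PP_bdd hq
  obtain ⟨B, hB0, hB⟩ := RR_bdd hq
  have hA0 : 0 ≤ A := (norm_nonneg _).trans (hA 0)
  refine ⟨A * B * B, fun E n j => ?_⟩
  simp only [aa, norm_mul]
  gcongr
  · exact hA _
  · exact hB _
  · exact hB _

lemma aa_tendsto {q : ℂ} (hq : ‖q‖ < 1) (E : ℤ → ℂ) (j : ℤ) :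
    Tendsto (fun n => aa q E n j) atTop (𝓝 ((Pinf q)⁻¹ * E j)) := by
  have h1 : Tendsto (fun n : ℕ => 2 * n) atTop atTop :=
    tendsto_id.const_mul_atTop' (by norm_num)
  have h2 : Tendsto (fun n : ℕ => (n : ℤ) + j) atTop atTop :=
    tendsto_atTop_add_const_right _ _ tendsto_natCast_atTop_atTop
  have h3 : Tendsto (fun n : ℕ => (n : ℤ) - j) atTop atTop := by
    simpa [sub_eq_add_neg] using
      tendsto_atTop_add_const_right _ (-j) (tendsto_natCast_atTop_atTop (R := ℤ))
  have := ((((PP_tendsto hq).comp h1).mul ((RR_tendsto hq).comp h2)).mul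
    ((RR_tendsto hq).comp h3)).mul_const (E j)
  have hne := Pinf_ne hq
  rw [mul_inv_cancel₀ hne, one_mul] at this
  exact this

lemma lim_sum {q : ℂ} (hq : ‖q‖ < 1) (E c : ℤ → ℂ) (h : Summable fun j => c j * E j) :
    Tendsto (fun n => ∑' j, c j * aa q E n j) atTop (𝓝 ((Pinf q)⁻¹ * ∑' j, c j * E j)) := by
  obtain ⟨C, hC⟩ := aa_bdd hq
  rw [← tsum_mul_left]
  refine tendsto_tsum_of_dominated_convergence (bound := fun j => C * ‖c j * E j‖)
    (h.norm.mul_left C) (fun j => ?_) (Eventually.of_forall fun n j => ?_)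
  · simpa [mul_left_comm] using (aa_tendsto hq E j).const_mul (c j)
  · rw [norm_mul, norm_mul, mul_left_comm]
    exact mul_le_mul_of_nonneg_left (hC E n j) (norm_nonneg _)

lemma summ {q : ℂ} (hq : ‖q‖ < 1) (E c : ℤ → ℂ) (h : Summable fun j => c j * E j) (n : ℕ) :
    Summable fun j => c j * aa q E n j := by
  obtain ⟨C, hC⟩ := aa_bdd hq
  refine (h.norm.mul_left C).of_norm_bounded (fun j => ?_)
  rw [norm_mul, norm_mul, mul_left_comm]
  exact mul_le_mul_of_nonneg_left (hC E n j) (norm_nonneg _)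

lemma aa_zero (q : ℂ) (E : ℤ → ℂ) (hE0 : E 0 = 1) (j : ℤ) :
    aa q E 0 j = if j = 0 then 1 else 0 := by
  split_ifs with h
  · subst h; simp [aa, RR, PP, hE0]
  · rcases lt_or_gt_of_ne h with h | h
    · simp [aa, RR, h]
    · simp [aa, RR, h]

lemma Z_rec {q s : ℂ} (hq0 : q ≠ 0) (hq : ‖q‖ < 1) (hs : s ^ 2 = 1) (E : ℤ → ℂ)
    (hE : ∀ j, E (j + 1) = s * q ^ (j + 1) * E j) (h : Summable E) (n : ℕ) :
    ∑' j, aa q E (n + 1) j =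
      (1 + q ^ (2 * n + 1) + s * q ^ (n + 1) + s * q ^ n) * ∑' j, aa q E n j := by
  have h0 : Summable (aa q E n) := by simpa using summ hq E 1 (by simpa using h) n
  have hm : HasSum (fun j => aa q E n (j - 1)) (∑' j, aa q E n j) :=
    hs_sub h0.hasSum
  have hp : HasSum (fun j => aa q E n (j + 1)) (∑' j, aa q E n j) :=
    hs_add h0.hasSum
  rw [tsum_congr (aa_rec hq0 hq hs E hE n)]
  rw [(((h0.hasSum.mul_left _).add (hm.mul_left _)).add (hp.mul_left _)).tsum_eq]
  ring

lemma S_rec {q s : ℂ} (hq0 : q ≠ 0) (hq : ‖q‖ < 1) (hs : s ^ 2 = 1) (E : ℤ → ℂ)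
    (hE : ∀ j, E (j + 1) = s * q ^ (j + 1) * E j) (h : Summable E)
    (h' : Summable fun j : ℤ => (j : ℂ) * E j) (n : ℕ) :
    ∑' j : ℤ, (j : ℂ) * aa q E (n + 1) j =
      (1 + q ^ (2 * n + 1) + s * q ^ (n + 1) + s * q ^ n) * ∑' j : ℤ, (j : ℂ) * aa q E n j
      + (s * q ^ (n + 1) - s * q ^ n) * ∑' j, aa q E n j := by
  have h0 : Summable (aa q E n) := by simpa using summ hq E 1 (by simpa using h) n
  have h1 := summ hq E _ h' n
  have hm : HasSum (fun j : ℤ => ((j - 1 : ℤ) : ℂ) * aa q E n (j - 1) + aa q E n (j - 1))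
      (∑' j : ℤ, (j : ℂ) * aa q E n j + ∑' j, aa q E n j) :=
    hs_sub (f := fun j : ℤ => (j : ℂ) * aa q E n j + aa q E n j) (h1.hasSum.add h0.hasSum)
  have hp : HasSum (fun j : ℤ => ((j + 1 : ℤ) : ℂ) * aa q E n (j + 1) - aa q E n (j + 1))
      (∑' j : ℤ, (j : ℂ) * aa q E n j - ∑' j, aa q E n j) :=
    hs_add (f := fun j : ℤ => (j : ℂ) * aa q E n j - aa q E n j) (h1.hasSum.sub h0.hasSum)
  have := (((h1.hasSum.mul_left (1 + q ^ (2 * n + 1))).add (hm.mul_left (s * q ^ (n + 1)))).add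
    (hp.mul_left (s * q ^ n))).tsum_eq
  rw [show (1 + q ^ (2 * n + 1) + s * q ^ (n + 1) + s * q ^ n) * ∑' j : ℤ, (j : ℂ) * aa q E n j
      + (s * q ^ (n + 1) - s * q ^ n) * ∑' j, aa q E n j = _ by
    refine Eq.trans ?_ this.symm
    ring]
  refine tsum_congr fun j => ?_
  rw [aa_rec hq0 hq hs E hE n]
  push_cast
  ring

lemma Z0 (q : ℂ) (E : ℤ → ℂ) (hE0 : E 0 = 1) : ∑' j, aa q E 0 j = 1 := by
  simp_rw [aa_zero q E hE0]; simp

lemma S0 (q : ℂ) (E : ℤ → ℂ) (hE0 : E 0 = 1) : ∑' j : ℤ, (j : ℂ) * aa q E 0 j = 0 := by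
  simp_rw [aa_zero q E hE0]; simp

lemma PP_sq_succ (q : ℂ) (n : ℕ) :
    PP (q ^ 2) (n + 1) = PP (q ^ 2) n * ((1 - q ^ (n + 1)) * (1 + q ^ (n + 1))) := by
  rw [PP_succ]; ring

theorem sum_plus {q : ℂ} (hq0 : q ≠ 0) (hq : ‖q‖ < 1) (E : ℤ → ℂ)
    (hE : ∀ j, E (j + 1) = q ^ (j + 1) * E j) (hE0 : E 0 = 1) (h : Summable E) :
    ∑' j, E j = 2 * Pinf (q ^ 2) ^ 2 / Pinf q := by
  have hq2 : ‖q ^ 2‖ < 1 := by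
    rw [norm_pow]; exact pow_lt_one₀ (norm_nonneg _) hq (by norm_num)
  have hE' : ∀ j, E (j + 1) = 1 * q ^ (j + 1) * E j := by simpa using hE
  have hZ : ∀ n, ∑' j, aa q E (n + 1) j =
      2 * PP (q ^ 2) n * PP (q ^ 2) (n + 1) / (PP q n * PP q (n + 1)) := by
    intro n
    induction n with
    | zero =>
      rw [Z_rec hq0 hq (by norm_num) E hE' h, Z0 q E hE0]
      have := one_sub_ne hq 0
      simp [PP] at this ⊢
      field_simp
      ring
    | succ n ih =>
      rw [Z_rec hq0 hq (by norm_num) E hE' h, ih, PP_sq_succ q (n + 1), PP_sq_succ q n,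
        PP_succ q (n + 1), PP_succ q n]
      have := one_sub_ne hq n
      have := one_sub_ne hq (n + 1)
      have := PP_ne hq n
      field_simp
      ring
  have l1 := (lim_sum hq E 1 (by simpa using h)).comp (tendsto_add_atTop_nat 1)
  simp only [Function.comp_def, Pi.one_apply, one_mul, hZ] at l1
  have l2 := (((PP_tendsto hq2).const_mul 2).mul ((PP_tendsto hq2).comp (tendsto_add_atTop_nat 1))).div
    ((PP_tendsto hq).mul ((PP_tendsto hq).comp (tendsto_add_atTop_nat 1)))
    (mul_ne_zero (Pinf_ne hq) (Pinf_ne hq))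
  have := tendsto_nhds_unique l1 l2
  have hne := Pinf_ne hq
  field_simp at this ⊢
  linear_combination this

theorem sum_minus {q : ℂ} (hq0 : q ≠ 0) (hq : ‖q‖ < 1) (E : ℤ → ℂ)
    (hE : ∀ j, E (j + 1) = -1 * q ^ (j + 1) * E j) (hE0 : E 0 = 1) (h : Summable E)
    (h' : Summable fun j : ℤ => (j : ℂ) * E j) :
    ∑' j, E j = 0 ∧ ∑' j : ℤ, (j : ℂ) * E j = Pinf q ^ 3 := by
  have hZ : ∀ n, ∑' j, aa q E (n + 1) j = 0 := by
    intro n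
    induction n with
    | zero =>
      rw [Z_rec hq0 hq (by norm_num) E hE h, Z0 q E hE0]
      ring
    | succ n ih => rw [Z_rec hq0 hq (by norm_num) E hE h, ih, mul_zero]
  have hS : ∀ n, ∑' j : ℤ, (j : ℂ) * aa q E (n + 1) j = PP q n * PP q (n + 1) := by
    intro n
    induction n with
    | zero =>
      rw [S_rec hq0 hq (by norm_num) E hE h h', Z0 q E hE0, S0 q E hE0]
      simp [PP]; ring
    | succ n ih =>
      rw [S_rec hq0 hq (by norm_num) E hE h h', ih, hZ, PP_succ q (n + 1), PP_succ q n]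
      ring
  have hne := Pinf_ne hq
  constructor
  · have l1 := (lim_sum hq E 1 (by simpa using h)).comp (tendsto_add_atTop_nat 1)
    simp only [Function.comp_def, Pi.one_apply, one_mul, hZ] at l1
    have := tendsto_nhds_unique l1 tendsto_const_nhds
    simpa [hne] using this
  · have l1 := (lim_sum hq E _ h').comp (tendsto_add_atTop_nat 1)
    simp only [Function.comp_def, hS] at l1
    have l2 := ((PP_tendsto hq).mul ((PP_tendsto hq).comp (tendsto_add_atTop_nat 1)))
    have := tendsto_nhds_unique l1 l2
    field_simp at this ⊢
    linear_combination this

end KW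

namespace KW

lemma norm_q {τ : ℂ} (hτ : 0 < τ.im) : ‖Complex.exp (2 * π * Complex.I * τ)‖ < 1 := by
  simpa using UpperHalfPlane.norm_exp_two_pi_I_lt_one ⟨τ, hτ⟩

lemma eta_eq (τ : ℂ) : dedekindEta τ =
    Complex.exp (π * Complex.I * τ / 12) * Pinf (Complex.exp (2 * π * Complex.I * τ)) := by
  unfold dedekindEta Pinf
  congr 1
  refine tprod_congr fun k => ?_
  rw [← Complex.exp_nat_mul]
  congr 2
  push_cast
  ring

lemma theta_eq (z τ : ℂ) : jacobiThetaKW z τ =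
    Complex.exp (π * Complex.I * τ / 4 + π * Complex.I * (z + 1 / 2)) *
      jacobiTheta₂ (z + 1 / 2 + τ / 2) τ := by
  unfold jacobiThetaKW jacobiTheta₂
  rw [← tsum_mul_left]
  refine tsum_congr fun n => ?_
  rw [jacobiTheta₂_term, ← Complex.exp_add]
  congr 1
  ring

lemma theta_plus {τ : ℂ} (hτ : 0 < τ.im) : jacobiTheta₂ (τ / 2) τ =
    2 * Pinf (Complex.exp (2 * π * Complex.I * τ) ^ 2) ^ 2 /
      Pinf (Complex.exp (2 * π * Complex.I * τ)) := by
  refine sum_plus (Complex.exp_ne_zero _) (norm_q hτ) (fun n => jacobiTheta₂_term n (τ / 2) τ)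
    (fun j => ?_) (by simp [jacobiTheta₂_term]) ((summable_jacobiTheta₂_term_iff _ _).mpr hτ)
  rw [jacobiTheta₂_term, jacobiTheta₂_term, ← Complex.exp_int_mul, ← Complex.exp_add]
  congr 1
  push_cast
  ring

lemma theta_minus {τ : ℂ} (hτ : 0 < τ.im) : jacobiTheta₂ (1 / 2 + τ / 2) τ = 0 ∧
    jacobiTheta₂' (1 / 2 + τ / 2) τ =
      2 * π * Complex.I * Pinf (Complex.exp (2 * π * Complex.I * τ)) ^ 3 := by
  have hpi : (2 * π * Complex.I : ℂ) ≠ 0 := Complex.two_pi_I_ne_zero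
  have hs := (summable_jacobiTheta₂'_term_iff (1 / 2 + τ / 2) τ).mpr hτ
  have hs' : Summable fun j : ℤ => (j : ℂ) * jacobiTheta₂_term j (1 / 2 + τ / 2) τ := by
    refine (hs.mul_left (2 * π * Complex.I : ℂ)⁻¹).congr fun j => ?_
    rw [jacobiTheta₂'_term]
    field_simp
  obtain ⟨h1, h2⟩ := sum_minus (Complex.exp_ne_zero _) (norm_q hτ)
    (fun n => jacobiTheta₂_term n (1 / 2 + τ / 2) τ)
    (fun j => by
      rw [jacobiTheta₂_term, jacobiTheta₂_term, ← Complex.exp_int_mul, ← Complex.exp_pi_mul_I,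
        ← Complex.exp_add, ← Complex.exp_add]
      congr 1
      push_cast
      ring) (by simp [jacobiTheta₂_term])
    ((summable_jacobiTheta₂_term_iff _ _).mpr hτ) hs'
  refine ⟨h1, ?_⟩
  rw [← h2, jacobiTheta₂', ← tsum_mul_left]
  refine tsum_congr fun j => ?_
  rw [jacobiTheta₂'_term]
  ring

lemma theta_zero {τ : ℂ} (hτ : 0 < τ.im) : jacobiThetaKW 0 τ = 0 := by
  rw [theta_eq, zero_add, (theta_minus hτ).1, mul_zero]

lemma theta_deriv {τ : ℂ} (hτ : 0 < τ.im) :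
    HasDerivAt (fun z => jacobiThetaKW z τ) (-2 * π * dedekindEta τ ^ 3) 0 := by
  have h1 : HasDerivAt (fun z : ℂ => jacobiTheta₂ (z + 1 / 2 + τ / 2) τ)
      (jacobiTheta₂' (1 / 2 + τ / 2) τ) 0 := by
    have := hasDerivAt_jacobiTheta₂_fst (0 + (1 / 2 + τ / 2)) hτ
    simpa [add_assoc] using this.comp_add_const (0 : ℂ) (1 / 2 + τ / 2)
  have h2 : HasDerivAt (fun z : ℂ => π * Complex.I * τ / 4 + π * Complex.I * (z + 1 / 2))
      (π * Complex.I) 0 := by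
    simpa only [mul_one] using! (((hasDerivAt_id (0 : ℂ)).add_const (1 / 2)).const_mul
      (π * Complex.I)).const_add (π * Complex.I * τ / 4)
  have h3 := h2.cexp.mul h1
  have h4 : (fun z => jacobiThetaKW z τ) = fun z =>
    Complex.exp (π * Complex.I * τ / 4 + π * Complex.I * (z + 1 / 2)) *
      jacobiTheta₂ (z + 1 / 2 + τ / 2) τ := funext fun z => theta_eq z τ
  rw [h4]
  refine HasDerivAt.congr_deriv (f := _) h3 (Eq.symm ?_)
  rw [zero_add, (theta_minus hτ).1, (theta_minus hτ).2, eta_eq, mul_pow, ← Complex.exp_nat_mul,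
    Complex.exp_add, show (π : ℂ) * Complex.I * (1 / 2) = π / 2 * Complex.I by ring,
    Complex.exp_pi_div_two_mul_I,
    show ((3 : ℕ) : ℂ) * (π * Complex.I * τ / 12) = π * Complex.I * τ / 4 by push_cast; ring]
  linear_combination (-2 * π * Complex.exp (π * Complex.I * τ / 4) *
    Pinf (Complex.exp (2 * π * Complex.I * τ)) ^ 3) * Complex.I_sq

lemma eta_ne {τ : ℂ} (hτ : 0 < τ.im) : dedekindEta τ ≠ 0 := by
  rw [eta_eq]
  exact mul_ne_zero (Complex.exp_ne_zero _) (Pinf_ne (norm_q hτ))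

lemma theta_half {τ : ℂ} (hτ : 0 < τ.im) :
    jacobiThetaKW (1 / 2) τ = -(2 * dedekindEta (2 * τ) ^ 2 / dedekindEta τ) := by
  have hne := Pinf_ne (norm_q hτ)
  have h1 : Complex.exp (2 * π * Complex.I * (2 * τ)) = Complex.exp (2 * π * Complex.I * τ) ^ 2 := by
    rw [← Complex.exp_nat_mul]; congr 1; push_cast; ring
  have h2 : Complex.exp (π * Complex.I * (2 * τ) / 12) ^ 2 =
      Complex.exp (π * Complex.I * τ / 4) * Complex.exp (π * Complex.I * τ / 12) := by
    rw [← Complex.exp_nat_mul, ← Complex.exp_add]; congr 1; push_cast; ring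
  rw [theta_eq, show (1 / 2 + 1 / 2 + τ / 2 : ℂ) = τ / 2 + 1 by ring, jacobiTheta₂_add_left,
    theta_plus hτ, eta_eq, eta_eq, h1, mul_pow, h2, Complex.exp_add,
    show (π : ℂ) * Complex.I * (1 / 2 + 1 / 2) = π * Complex.I by ring, Complex.exp_pi_mul_I]
  have := Complex.exp_ne_zero (π * Complex.I * τ / 12)
  field_simp

lemma theta_half_cont {τ : ℂ} (hτ : 0 < τ.im) :
    Tendsto (fun ε : ℂ => jacobiThetaKW (ε + 1 / 2) τ) (𝓝[≠] 0) (𝓝 (jacobiThetaKW (1 / 2) τ)) := by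
  have h : ContinuousAt (fun ε : ℂ => jacobiThetaKW (ε + 1 / 2) τ) 0 := by
    simp_rw [theta_eq]
    refine ContinuousAt.mul (by fun_prop) ?_
    exact ContinuousAt.comp (g := fun z => jacobiTheta₂ z τ)
      (f := fun ε : ℂ => ε + 1 / 2 + 1 / 2 + τ / 2)
      (differentiableAt_jacobiTheta₂_fst _ hτ).continuousAt (by fun_prop)
  simpa using h.tendsto.mono_left nhdsWithin_le_nhds

end KW

/-- Let `m` be a positive even integer. For every `τ ∈ ℍ`,
`lim_{ε→0} (2πiε)² · ϑ(ε + 1/2; τ)^m / ϑ(ε; τ)² = −2^m · η(2τ)^{2m} / η(τ)^{m+6}`. -/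
theorem stmt_11 (m : ℕ) (hm : 0 < m) (hme : Even m) (τ : ℂ) (hτ : 0 < τ.im) :
    Filter.Tendsto
      (fun ε : ℂ => (2 * π * Complex.I * ε) ^ 2 * jacobiThetaKW (ε + 1 / 2) τ ^ m /
        jacobiThetaKW ε τ ^ 2)
      (nhdsWithin 0 {0}ᶜ)
      (nhds (-2 ^ m * dedekindEta (2 * τ) ^ (2 * m) / dedekindEta τ ^ (m + 6))) := by
  have hη := KW.eta_ne hτ
  have hpi : (π : ℂ) ≠ 0 := by exact_mod_cast Real.pi_ne_zero
  have hd := hasDerivAt_iff_tendsto_slope.mp (KW.theta_deriv hτ)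
  have hd0 : (-2 * π * dedekindEta τ ^ 3 : ℂ) ≠ 0 := by
    simp [hη, hpi]
  have h1 := ((KW.theta_half_cont hτ).pow m).const_mul ((2 * π * Complex.I : ℂ) ^ 2)
  have h2 := h1.div (hd.pow 2) (pow_ne_zero 2 hd0)
  refine (h2.congr' ?_).trans (le_of_eq ?_)
  · filter_upwards [self_mem_nhdsWithin] with ε hε
    have hε' : ε ≠ 0 := hε
    simp only [Pi.div_apply, slope_def_field, KW.theta_zero hτ, sub_zero]
    by_cases h0 : jacobiThetaKW ε τ = 0
    · simp [h0]
    · field_simp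
  · congr 1
    rw [KW.theta_half hτ, hme.neg_pow, mul_pow (2 * (π : ℂ)) Complex.I 2,
      Complex.I_sq, div_pow, mul_pow 2 (dedekindEta (2 * τ) ^ 2) m, pow_mul (dedekindEta (2 * τ)) 2 m]
    field_simp
    ring
end
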